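/- Let P be a dcpo, let B = {m/2^n : m, n ∈ ℕ, m ≤ 2^n} be the dyadic rationals in [0,1], and for each b ∈ B let F(b) be a nonempty finite subset of P such that (a) ↑F(b₂) ⊆ int_{σ(P)}(↑F(b₁)) whenever b₁ < b₂ in B, and (b) for every b ∈ B, ↑F(b) is not Scott open (i.e., int_{σ(P)}(↑F(b)) ≠ ↑F(b)). Define f : P → [0,1] by f(y) = sup{b ∈ B : y ∈ ↑F(b)} if y ∈ ↑F(0) and f(y) = 0 otherwise. Then f is monotone, Lawson continuous, and surjective onto [0,1]. -/

import Mathlib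

open Set

/-- The upper set `↑A` generated by a subset `A` of a preordered set. -/
def upSet {P : Type*} [Preorder P] (A : Set P) : Set P := {y | ∃ a ∈ A, a ≤ y}

/-- The lower set `↓A` generated by a subset `A` of a preordered set. -/
def downSet {P : Type*} [Preorder P] (A : Set P) : Set P := {y | ∃ a ∈ A, y ≤ a}

/-- A poset is a dcpo if every (nonempty) directed subset has a least upper bound. -/
def IsDcpo (P : Type*) [Preorder P] : Prop :=
  ∀ D : Set P, D.Nonempty → DirectedOn (· ≤ ·) D → ∃ s, IsLUB D s

/-- A subset `U` is Scott open if it is an upper set and every directed set whose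
supremum lies in `U` meets `U`. -/
def ScottOpen {P : Type*} [Preorder P] (U : Set P) : Prop :=
  IsUpperSet U ∧ ∀ D : Set P, ∀ s : P, D.Nonempty → DirectedOn (· ≤ ·) D →
    IsLUB D s → s ∈ U → (D ∩ U).Nonempty

/-- The Scott topology `σ(P)`. -/
def scottT (P : Type*) [Preorder P] : TopologicalSpace P where
  IsOpen := ScottOpen
  isOpen_univ := ⟨isUpperSet_univ, fun D _ hD _ _ _ => hD.imp fun _ hd => ⟨hd, trivial⟩⟩
  isOpen_inter := by
    rintro U V ⟨hU, hU'⟩ ⟨hV, hV'⟩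
    refine ⟨hU.inter hV, fun D s hD hdir hlub hs => ?_⟩
    obtain ⟨d₁, hd₁D, hd₁U⟩ := hU' D s hD hdir hlub hs.1
    obtain ⟨d₂, hd₂D, hd₂V⟩ := hV' D s hD hdir hlub hs.2
    obtain ⟨d, hdD, h₁, h₂⟩ := hdir d₁ hd₁D d₂ hd₂D
    exact ⟨d, hdD, hU h₁ hd₁U, hV h₂ hd₂V⟩
  isOpen_sUnion := by
    intro S hS
    refine ⟨isUpperSet_sUnion fun U hU => (hS U hU).1, fun D s hD hdir hlub hs => ?_⟩
    obtain ⟨U, hUS, hsU⟩ := hs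
    obtain ⟨d, hdD, hdU⟩ := (hS U hUS).2 D s hD hdir hlub hsU
    exact ⟨d, hdD, U, hUS, hdU⟩

/-- Scott interior. -/
def scottInt (P : Type*) [Preorder P] (A : Set P) : Set P := @interior P (scottT P) A

/-- Scott closure. -/
def scottCl (P : Type*) [Preorder P] (A : Set P) : Set P := @closure P (scottT P) A

/-- The lower topology `ω(P)`, generated by the complements of principal upper sets. -/
def lowerT (P : Type*) [Preorder P] : TopologicalSpace P :=
  .generateFrom {V | ∃ x : P, V = (Ici x)ᶜ}

/-- The upper topology `υ(P)`, generated by the complements of principal lower sets. -/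
def upperT (P : Type*) [Preorder P] : TopologicalSpace P :=
  .generateFrom {V | ∃ x : P, V = (Iic x)ᶜ}

/-- The Lawson topology `λ(P)`, generated by `σ(P) ∪ ω(P)`. -/
def lawsonT (P : Type*) [Preorder P] : TopologicalSpace P :=
  .generateFrom ({U | ScottOpen U} ∪ {V | ∃ x : P, V = (Ici x)ᶜ})

/-- The interval topology `θ(P)`, generated by `ω(P) ∪ υ(P)`. -/
def intervalT (P : Type*) [Preorder P] : TopologicalSpace P :=
  .generateFrom ({V | ∃ x : P, V = (Ici x)ᶜ} ∪ {V | ∃ x : P, V = (Iic x)ᶜ})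

/-- `A ≪ B`: for every directed set `D` with `sup D ∈ ↑B`, `D` meets `↑A`. -/
def WayBelowSet {P : Type*} [Preorder P] (A B : Set P) : Prop :=
  ∀ D : Set P, ∀ s : P, D.Nonempty → DirectedOn (· ≤ ·) D → IsLUB D s →
    s ∈ upSet B → (D ∩ upSet A).Nonempty

/-- `u ≪ x`: every directed set `D` with `sup D ≥ x` contains some `d ≥ u`. -/
def WayBelowPt {P : Type*} [Preorder P] (u x : P) : Prop :=
  ∀ D : Set P, ∀ s : P, D.Nonempty → DirectedOn (· ≤ ·) D → IsLUB D s →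
    x ≤ s → ∃ d ∈ D, u ≤ d

/-- A family of sets is filtered if it is (nonempty and) directed under reverse inclusion. -/
def Filtered {P : Type*} (𝒜 : Set (Set P)) : Prop :=
  𝒜.Nonempty ∧ ∀ S ∈ 𝒜, ∀ T ∈ 𝒜, ∃ R ∈ 𝒜, R ⊆ S ∧ R ⊆ T

/-- The family `{↑F : F nonempty finite, F ≪ x}`. -/
def finWayFamily {P : Type*} [Preorder P] (x : P) : Set (Set P) :=
  {S | ∃ F : Set P, F.Nonempty ∧ F.Finite ∧ WayBelowSet F {x} ∧ S = upSet F}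

/-- A quasicontinuous domain. -/
def IsQuasicontinuousDomain (P : Type*) [Preorder P] : Prop :=
  ∀ x : P, Filtered (finWayFamily x) ∧ Ici x = ⋂₀ finWayFamily x

/-- The family `{↑F : F nonempty finite, x ∈ ↑F, F ≪ F}`. -/
def finCompactFamily {P : Type*} [Preorder P] (x : P) : Set (Set P) :=
  {S | ∃ F : Set P, F.Nonempty ∧ F.Finite ∧ x ∈ upSet F ∧ WayBelowSet F F ∧ S = upSet F}

/-- A quasialgebraic domain. -/
def IsQuasialgebraicDomain (P : Type*) [Preorder P] : Prop :=
  ∀ x : P, Filtered (finCompactFamily x) ∧ Ici x = ⋂₀ finCompactFamily x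

/-- A continuous domain: every `⇓x` is directed (hence nonempty) with supremum `x`. -/
def IsContinuousDomain (P : Type*) [Preorder P] : Prop :=
  ∀ x : P, {u | WayBelowPt u x}.Nonempty ∧ DirectedOn (· ≤ ·) {u | WayBelowPt u x} ∧
    IsLUB {u | WayBelowPt u x} x

/-- The set `K(P)` of compact elements. -/
def compacts (P : Type*) [Preorder P] : Set P := {k | WayBelowPt k k}

/-- An algebraic domain. -/
def IsAlgebraicDomain (P : Type*) [Preorder P] : Prop :=
  ∀ x : P, (compacts P ∩ Iic x).Nonempty ∧ DirectedOn (· ≤ ·) (compacts P ∩ Iic x) ∧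
    IsLUB (compacts P ∩ Iic x) x

/-- A meet-continuous dcpo: whenever `x ≤ sup D` for a directed set `D`,
`x` lies in the Scott closure of `↓x ∩ ↓D`. -/
def MeetContinuous (P : Type*) [Preorder P] : Prop :=
  ∀ x : P, ∀ D : Set P, ∀ s : P, D.Nonempty → DirectedOn (· ≤ ·) D → IsLUB D s → x ≤ s →
    x ∈ scottCl P (Iic x ∩ downSet D)

/-- The set of dyadic rationals in `[0,1]`. -/
def dyadics : Set ℝ := {t | ∃ m n : ℕ, m ≤ 2 ^ n ∧ t = (m : ℝ) / 2 ^ n}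

theorem isUpperSet_upSet {P : Type*} [Preorder P] (A : Set P) : IsUpperSet (upSet A) :=
  fun _ _ hxy ⟨a, ha, hax⟩ => ⟨a, ha, hax.trans hxy⟩

theorem subset_upSet {P : Type*} [Preorder P] (A : Set P) : A ⊆ upSet A :=
  fun a ha => ⟨a, ha, le_rfl⟩

theorem upSet_subset_iff {P : Type*} [Preorder P] {A U : Set P} (hU : IsUpperSet U) :
    upSet A ⊆ U ↔ A ⊆ U :=
  ⟨(subset_upSet A).trans, fun h _ ⟨_, ha, hay⟩ => hU hay (h ha)⟩

theorem scottInt_subset {P : Type*} [Preorder P] (A : Set P) : scottInt P A ⊆ A :=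
  @interior_subset P (scottT P) A

theorem scottOpen_of_forall_mem_scottInt {P : Type*} [Preorder P] {U : Set P}
    (h : ∀ y ∈ U, ∃ A ⊆ U, y ∈ scottInt P A) : ScottOpen U := by
  let := scottT P
  change IsOpen U
  refine isOpen_iff_forall_mem_open.2 fun y hy => ?_
  obtain ⟨A, hAU, hyA⟩ := h y hy
  exact ⟨interior A, interior_subset.trans hAU, isOpen_interior, hyA⟩

theorem isOpen_lawsonT_compl_upSet {P : Type*} [Preorder P] {A : Set P} (hA : A.Finite) :
    @IsOpen P (lawsonT P) (upSet A)ᶜ := by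
  let := lawsonT P
  have h : (upSet A)ᶜ = ⋂ a ∈ A, (Ici a)ᶜ := by
    ext y
    simp [upSet]
  rw [h]
  exact hA.isOpen_biInter fun a _ => .basic _ (Or.inr ⟨a, rfl⟩)

/-- A form of Kőnig's lemma: finite nonempty sets, each refining its predecessor, admit an
increasing selection. -/
theorem exists_monotone_selection {P : Type*} [Preorder P] (G : ℕ → Set P)
    (hne : ∀ n, (G n).Nonempty) (hfin : ∀ n, (G n).Finite)
    (hG : ∀ n, ∀ x ∈ G (n + 1), ∃ y ∈ G n, y ≤ x) :
    ∃ x : ℕ → P, Monotone x ∧ ∀ n, x n ∈ G n := by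
  choose! g hgmem hgle using hG
  let Φ : CategoryTheory.Functor ℕᵒᵖ (Type _) := CategoryTheory.Functor.ofOpSequence (X := fun n => ↥(G n))
    fun n => TypeCat.ofHom fun x => ⟨g n x, hgmem n x x.2⟩
  have hΦfin : ∀ j, Finite (Φ.obj j) := fun j => (hfin j.unop).to_subtype
  have hΦne : ∀ j, Nonempty (Φ.obj j) := fun j => (hne j.unop).to_subtype
  obtain ⟨s, hs⟩ := nonempty_sections_of_finite_cofiltered_system Φ
  let x : ∀ n, ↥(G n) := fun n => s (.op n)
  refine ⟨fun n => x n, monotone_nat_of_le_succ fun n => ?_, fun n => (x n).2⟩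
  have hmap := hs (CategoryTheory.homOfLE n.le_succ).op
  have hstep : Φ.map (CategoryTheory.homOfLE n.le_succ).op = _ :=
    CategoryTheory.Functor.ofOpSequence_map_homOfLE_succ _ n
  rw [hstep] at hmap
  have hx : g n (x (n + 1)) = x n := congrArg Subtype.val hmap
  rw [← hx]
  exact hgle n _ (x (n + 1)).2

/-- In a dcpo, a decreasing sequence of finitely generated upper sets, none of which is contained
in the Scott open set `U`, has an intersection not contained in `U`. -/
theorem exists_notMem_forall_mem_upSet {P : Type*} [Preorder P] (hdcpo : IsDcpo P)
    {U : Set P} (hU : ScottOpen U) (F : ℕ → Set P) (hfin : ∀ n, (F n).Finite)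
    (hanti : ∀ n, upSet (F (n + 1)) ⊆ upSet (F n)) (hFU : ∀ n, ¬ F n ⊆ U) :
    ∃ y ∉ U, ∀ n, y ∈ upSet (F n) := by
  obtain ⟨x, hx, hxF⟩ := exists_monotone_selection (fun n => F n \ U)
    (fun n => sdiff_nonempty.2 (hFU n)) (fun n => (hfin n).sdiff) fun n z hz => by
      obtain ⟨y, hy, hyz⟩ := hanti n (subset_upSet _ hz.1)
      exact ⟨y, ⟨hy, fun hyU => hz.2 (hU.1 hyz hyU)⟩, hyz⟩
  obtain ⟨s, hs⟩ := hdcpo (range x) (range_nonempty x) (directedOn_range.2 hx.directed_le)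
  refine ⟨s, fun hsU => ?_, fun n => ⟨x n, (hxF n).1, hs.1 ⟨n, rfl⟩⟩⟩
  obtain ⟨_, ⟨n, rfl⟩, hn⟩ := hU.2 _ s (range_nonempty x) (directedOn_range.2 hx.directed_le) hs hsU
  exact (hxF n).2 hn

theorem dyadics_subset_Icc : dyadics ⊆ Icc 0 1 := by
  rintro _ ⟨m, n, hmn, rfl⟩
  refine ⟨by positivity, div_le_one_of_le₀ ?_ (by positivity)⟩
  exact_mod_cast hmn

theorem zero_mem_dyadics : (0 : ℝ) ∈ dyadics := ⟨0, 0, by simp, by simp⟩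

/-- The largest multiple of `2⁻ⁿ` that is at most `t`, for `0 ≤ t`. -/
noncomputable def dyadicApprox (t : ℝ) (n : ℕ) : ℝ := (⌊t * 2 ^ n⌋₊ : ℝ) / 2 ^ n

theorem dyadicApprox_mem {t : ℝ} (ht : t ≤ 1) (n : ℕ) : dyadicApprox t n ∈ dyadics := by
  refine ⟨_, n, Nat.floor_le_of_le ?_, rfl⟩
  push_cast
  exact mul_le_of_le_one_left (by positivity) ht

theorem dyadicApprox_le {t : ℝ} (ht : 0 ≤ t) (n : ℕ) : dyadicApprox t n ≤ t :=
  (div_le_iff₀ (by positivity)).2 (Nat.floor_le (by positivity))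

theorem sub_lt_dyadicApprox (t : ℝ) (n : ℕ) : t - (1 / 2) ^ n < dyadicApprox t n := by
  have h := Nat.lt_floor_add_one (t * 2 ^ n)
  rw [dyadicApprox, lt_div_iff₀ (by positivity), sub_mul, ← mul_pow]
  norm_num
  linarith

theorem dyadicApprox_le_succ {t : ℝ} (ht : 0 ≤ t) (n : ℕ) :
    dyadicApprox t n ≤ dyadicApprox t (n + 1) := by
  have h : 2 * ⌊t * 2 ^ n⌋₊ ≤ ⌊t * 2 ^ (n + 1)⌋₊ := by
    refine Nat.le_floor ?_
    push_cast
    have := Nat.floor_le (a := t * 2 ^ n) (by positivity)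
    rw [pow_succ]
    linarith
  have h' : (2 : ℝ) * ⌊t * 2 ^ n⌋₊ ≤ ⌊t * 2 ^ (n + 1)⌋₊ := mod_cast h
  rw [dyadicApprox, dyadicApprox, div_le_div_iff₀ (by positivity) (by positivity)]
  have := mul_le_mul_of_nonneg_right h' (pow_nonneg (zero_le_two (α := ℝ)) n)
  linarith [pow_succ (2 : ℝ) n, congrArg ((⌊t * 2 ^ n⌋₊ : ℝ) * ·) (pow_succ (2 : ℝ) n)]

theorem tendsto_dyadicApprox {t : ℝ} (ht : 0 ≤ t) :
    Filter.Tendsto (dyadicApprox t) Filter.atTop (nhds t) := by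
  refine tendsto_of_tendsto_of_tendsto_of_le_of_le ?_ tendsto_const_nhds
    (fun n => (sub_lt_dyadicApprox t n).le) (dyadicApprox_le ht)
  simpa using tendsto_const_nhds.sub
    (tendsto_pow_atTop_nhds_zero_of_lt_one (r := (1 / 2 : ℝ)) (by norm_num) (by norm_num))

theorem exists_mem_dyadics_between {a c : ℝ} (ha : 0 ≤ a) (hac : a < c) (hc : c ≤ 1) :
    ∃ b ∈ dyadics, a < b ∧ b < c := by
  obtain ⟨d, had, hdc⟩ := exists_between hac
  obtain ⟨n, hn⟩ := ((tendsto_dyadicApprox (ha.trans had.le)).eventually_const_lt had).exists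
  exact ⟨_, dyadicApprox_mem (hdc.le.trans hc) n, hn,
    (dyadicApprox_le (ha.trans had.le) n).trans_lt hdc⟩

/-- The function `f` takes values in `[0,1]`, and its superlevel sets are sandwiched between the
upper sets `↑F(b)`. -/
structure IsDyadicLevelFunction {P : Type*} [Preorder P] (F : ℝ → Set P) (f : P → ℝ) : Prop where
  mem_Icc : ∀ y, f y ∈ Icc (0 : ℝ) 1
  le_of_mem : ∀ b ∈ dyadics, ∀ y ∈ upSet (F b), b ≤ f y
  mem_of_lt : ∀ b ∈ dyadics, ∀ y, b < f y → y ∈ upSet (F b)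

open scoped Classical in
theorem isDyadicLevelFunction_of_eq_sSup {P : Type*} [Preorder P] {F : ℝ → Set P}
    (hanti : ∀ b₁ ∈ dyadics, ∀ b₂ ∈ dyadics, b₁ < b₂ → upSet (F b₂) ⊆ upSet (F b₁))
    {f : P → ℝ}
    (hf : ∀ y : P, f y =
      if y ∈ upSet (F 0) then sSup {b | b ∈ dyadics ∧ y ∈ upSet (F b)} else 0) :
    IsDyadicLevelFunction F f := by
  have hbdd (y : P) : BddAbove {b | b ∈ dyadics ∧ y ∈ upSet (F b)} :=
    ⟨1, fun b hb => (dyadics_subset_Icc hb.1).2⟩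
  refine ⟨fun y => ?_, fun b hb y hy => ?_, fun b hb y hy => ?_⟩
  · rw [hf]
    split_ifs with h
    · exact ⟨le_csSup (hbdd y) ⟨zero_mem_dyadics, h⟩,
        csSup_le ⟨0, zero_mem_dyadics, h⟩ fun b hb => (dyadics_subset_Icc hb.1).2⟩
    · simp
  · have h0 : y ∈ upSet (F 0) := by
      rcases (dyadics_subset_Icc hb).1.eq_or_lt with rfl | h
      · exact hy
      · exact hanti 0 zero_mem_dyadics b hb h hy
    rw [hf, if_pos h0]
    exact le_csSup (hbdd y) ⟨hb, hy⟩
  · rw [hf] at hy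
    split_ifs at hy with h
    · have hne : {b | b ∈ dyadics ∧ y ∈ upSet (F b)}.Nonempty := ⟨0, zero_mem_dyadics, h⟩
      obtain ⟨c, ⟨hc, hyc⟩, hbc⟩ := exists_lt_of_lt_csSup hne hy
      exact hanti b hb c hc hbc hyc
    · exact absurd hy (dyadics_subset_Icc hb).1.not_gt

namespace IsDyadicLevelFunction

theorem monotone {P : Type*} [Preorder P] {F : ℝ → Set P} {f : P → ℝ}
    (h : IsDyadicLevelFunction F f) : Monotone f := by
  intro x y hxy
  by_contra! hlt
  obtain ⟨b, hb, hyb, hbx⟩ := exists_mem_dyadics_between (h.mem_Icc y).1 hlt (h.mem_Icc x).2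
  exact hyb.not_ge (h.le_of_mem b hb y (isUpperSet_upSet _ hxy (h.mem_of_lt b hb x hbx)))

theorem scottOpen_lt {P : Type*} [Preorder P] {F : ℝ → Set P} {f : P → ℝ}
    (h : IsDyadicLevelFunction F f)
    (hmono : ∀ b₁ ∈ dyadics, ∀ b₂ ∈ dyadics, b₁ < b₂ →
      upSet (F b₂) ⊆ scottInt P (upSet (F b₁))) (a : ℝ) :
    ScottOpen {y | a < f y} := by
  refine scottOpen_of_forall_mem_scottInt fun y (hy : a < f y) => ?_
  rcases lt_or_ge a 0 with ha | ha
  · exact ⟨univ, fun z _ => ha.trans_le (h.mem_Icc z).1, by simp [scottInt]⟩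
  · obtain ⟨b, hb, hab, hby⟩ := exists_mem_dyadics_between ha hy (h.mem_Icc y).2
    obtain ⟨c, hc, hac, hcb⟩ := exists_mem_dyadics_between ha hab (dyadics_subset_Icc hb).2
    exact ⟨upSet (F c), fun z hz => hac.trans_le (h.le_of_mem c hc z hz),
      hmono c hc b hb hcb (h.mem_of_lt b hb y hby)⟩

theorem isOpen_lawsonT_gt {P : Type*} [Preorder P] {F : ℝ → Set P} {f : P → ℝ}
    (h : IsDyadicLevelFunction F f) (hfin : ∀ b ∈ dyadics, (F b).Finite) (a : ℝ) :
    @IsOpen P (lawsonT P) {y | f y < a} := by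
  let := lawsonT P
  refine isOpen_iff_forall_mem_open.2 fun y (hy : f y < a) => ?_
  rcases lt_or_ge 1 a with ha | ha
  · exact ⟨univ, fun z _ => (h.mem_Icc z).2.trans_lt ha, isOpen_univ, mem_univ y⟩
  · obtain ⟨b, hb, hyb, hba⟩ := exists_mem_dyadics_between (h.mem_Icc y).1 hy ha
    refine ⟨(upSet (F b))ᶜ, fun z hz => ?_, isOpen_lawsonT_compl_upSet (hfin b hb),
      fun hyF => hyb.not_ge (h.le_of_mem b hb y hyF)⟩
    exact (not_lt.1 fun hbz => hz (h.mem_of_lt b hb z hbz)).trans_lt hba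

theorem continuous_lawsonT {P : Type*} [Preorder P] {F : ℝ → Set P} {f : P → ℝ}
    (h : IsDyadicLevelFunction F f) (hfin : ∀ b ∈ dyadics, (F b).Finite)
    (hmono : ∀ b₁ ∈ dyadics, ∀ b₂ ∈ dyadics, b₁ < b₂ →
      upSet (F b₂) ⊆ scottInt P (upSet (F b₁))) :
    @Continuous P ℝ (lawsonT P) inferInstance f := by
  let := lawsonT P
  rw [OrderTopology.continuous_iff]
  exact fun a => ⟨.basic _ (Or.inl (h.scottOpen_lt hmono a)), h.isOpen_lawsonT_gt hfin a⟩

/-- Otherwise `↑F(b)` would lie in some `↑F(d)` with `t < d`, and `↑F(c)` would be Scott open for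
`b < c < d`. -/
theorem not_subset_lt {P : Type*} [Preorder P] {F : ℝ → Set P} {f : P → ℝ}
    (h : IsDyadicLevelFunction F f)
    (hne : ∀ b ∈ dyadics, (F b).Nonempty) (hfin : ∀ b ∈ dyadics, (F b).Finite)
    (hmono : ∀ b₁ ∈ dyadics, ∀ b₂ ∈ dyadics, b₁ < b₂ →
      upSet (F b₂) ⊆ scottInt P (upSet (F b₁)))
    (hnotopen : ∀ b ∈ dyadics, scottInt P (upSet (F b)) ≠ upSet (F b))
    {b t : ℝ} (hb : b ∈ dyadics) (hbt : b ≤ t) : ¬ F b ⊆ {y | t < f y} := by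
  intro hsub
  obtain ⟨y, hy, hmin⟩ := (hfin b hb).exists_minimalFor f _ (hne b hb)
  have ht : 0 ≤ t := (dyadics_subset_Icc hb).1.trans hbt
  obtain ⟨d, hd, htd, hdy⟩ := exists_mem_dyadics_between ht (hsub hy) (h.mem_Icc y).2
  obtain ⟨c, hc, htc, hcd⟩ := exists_mem_dyadics_between ht htd (dyadics_subset_Icc hd).2
  have hbd : upSet (F b) ⊆ upSet (F d) := by
    refine (upSet_subset_iff (isUpperSet_upSet _)).2 fun z hz => h.mem_of_lt d hd z ?_
    exact hdy.trans_le (le_of_not_gt fun hzy => hzy.not_ge (hmin hz hzy.le))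
  have hcb : upSet (F c) ⊆ upSet (F b) :=
    (hmono b hb c hc (hbt.trans_lt htc)).trans (scottInt_subset _)
  exact hnotopen c hc ((scottInt_subset _).antisymm
    ((hcb.trans hbd).trans (hmono c hc d hd hcd)))

theorem range_eq_Icc {P : Type*} [Preorder P] (hdcpo : IsDcpo P) {F : ℝ → Set P} {f : P → ℝ}
    (h : IsDyadicLevelFunction F f)
    (hne : ∀ b ∈ dyadics, (F b).Nonempty) (hfin : ∀ b ∈ dyadics, (F b).Finite)
    (hmono : ∀ b₁ ∈ dyadics, ∀ b₂ ∈ dyadics, b₁ < b₂ →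
      upSet (F b₂) ⊆ scottInt P (upSet (F b₁)))
    (hnotopen : ∀ b ∈ dyadics, scottInt P (upSet (F b)) ≠ upSet (F b)) :
    range f = Icc (0 : ℝ) 1 := by
  refine (range_subset_iff.2 h.mem_Icc).antisymm fun t ht => ?_
  have hmem := dyadicApprox_mem ht.2
  obtain ⟨y, hyt, hy⟩ := exists_notMem_forall_mem_upSet hdcpo (h.scottOpen_lt hmono t)
    (fun n => F (dyadicApprox t n)) (fun n => hfin _ (hmem n))
    (fun n => by
      rcases (dyadicApprox_le_succ ht.1 n).eq_or_lt with heq | hlt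
      · simp only [heq, subset_rfl]
      · exact (hmono _ (hmem n) _ (hmem (n + 1)) hlt).trans (scottInt_subset _))
    (fun n => h.not_subset_lt hne hfin hmono hnotopen (hmem n) (dyadicApprox_le ht.1 n))
  exact ⟨y, (not_lt.1 hyt).antisymm (le_of_tendsto' (tendsto_dyadicApprox ht.1)
    fun n => h.le_of_mem _ (hmem n) y (hy n))⟩

end IsDyadicLevelFunction

open scoped Classical in
/-- For a dyadically indexed family `F` with `↑F(b₂) ⊆ int_σ(↑F(b₁))` for
`b₁ < b₂` in `B` and with no `↑F(b)` Scott open, the function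
`f(y) = sup {b ∈ B : y ∈ ↑F(b)}` (for `y ∈ ↑F(0)`, else `0`) is monotone, Lawson continuous,
and surjective onto `[0,1]`. -/
theorem urysohn_function_monotone_lawson_continuous_surjective
    (P : Type*) [PartialOrder P] (hdcpo : IsDcpo P)
    (F : ℝ → Set P)
    (hne : ∀ b ∈ dyadics, (F b).Nonempty) (hfin : ∀ b ∈ dyadics, (F b).Finite)
    (hmono : ∀ b₁ ∈ dyadics, ∀ b₂ ∈ dyadics, b₁ < b₂ →
      upSet (F b₂) ⊆ scottInt P (upSet (F b₁)))
    (hnotopen : ∀ b ∈ dyadics, scottInt P (upSet (F b)) ≠ upSet (F b))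
    (f : P → ℝ)
    (hf : ∀ y : P, f y =
      if y ∈ upSet (F 0) then sSup {b | b ∈ dyadics ∧ y ∈ upSet (F b)} else 0) :
    Monotone f ∧ @Continuous P ℝ (lawsonT P) inferInstance f ∧
      Set.range f = Set.Icc (0 : ℝ) 1 := by
  have h := isDyadicLevelFunction_of_eq_sSup
    (fun b₁ h₁ b₂ h₂ hlt => (hmono b₁ h₁ b₂ h₂ hlt).trans (scottInt_subset _)) hf
  exact ⟨h.monotone, h.continuous_lawsonT hfin hmono,
    h.range_eq_Icc hdcpo hne hfin hmono hnotopen⟩
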